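/- arXiv:1611.01103 — 7 statements merged into one kernel-verified Lean document; each statement's English description precedes it below -/
import Mathlib

section
/- Let T be a group that does not admit a uniform automorphism, let k ≥ 2, and let X and Y be subgroups of T^k each of which is a direct product of pairwise disjoint nontrivial full strips (that is, X = X₁×⋯×X_r and Y = Y₁×⋯×Y_s where the X_i are nontrivial full strips of T^k with pairwise disjoint supports, and likewise the Y_j). Then XY ≠ T^k. -/
open scoped Pointwise

/-- A subgroup `H` of `T^k` is a full strip with support `S`: there is `i₀ ∈ S` and
automorphisms `φ i` of `T` for each `i` with `φ i₀ = id` such that `H` consists of all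
tuples `f` with `f i = φ i t` for `i ∈ S` (for a single `t ∈ T`) and `f i = 1` for `i ∉ S`. -/
def IsFullStrip {T : Type*} [Group T] {k : ℕ}
    (H : Subgroup (Fin k → T)) (S : Finset (Fin k)) : Prop :=
  ∃ (i₀ : Fin k) (_ : i₀ ∈ S) (φ : Fin k → T ≃* T), φ i₀ = MulEquiv.refl T ∧
    (H : Set (Fin k → T)) =
      {f | ∃ t : T, ∀ i, (i ∈ S → f i = φ i (t)) ∧ (i ∉ S → f i = 1)}

/-- A subgroup `X` of `T^k` is a direct product of pairwise disjoint nontrivial full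
strips: `X = X₁ × ⋯ × X_r` where each `X_i` is a full strip whose support has at least
two elements, and the supports are pairwise disjoint. -/
def IsProductOfDisjointNontrivialFullStrips {T : Type*} [Group T] {k : ℕ}
    (X : Subgroup (Fin k → T)) : Prop :=
  ∃ (r : ℕ) (H : Fin r → Subgroup (Fin k → T)) (S : Fin r → Finset (Fin k)),
    (∀ i, IsFullStrip (H i) (S i)) ∧ (∀ i, 2 ≤ (S i).card) ∧
      (∀ i j, i ≠ j → Disjoint (S i) (S j)) ∧ X = ⨆ i, H i

/-- A system of equations `z e = φ e (t (p e)) * (ψ e (t (q e)))⁻¹`, indexed by the edges `e` of a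
multigraph with at least as many edges as vertices, is not solvable for every `z` unless `T` has a
uniform automorphism. -/
lemma exists_unsolvable_of_card_le {T ι V : Type*} [Group T] [DecidableEq ι] [DecidableEq V]
    (hT : ∀ α : T ≃* T, ¬ Function.Surjective fun g : T => g⁻¹ * α g)
    (E : Finset ι) (W : Finset V) (hE : E.Nonempty) (hcard : W.card ≤ E.card)
    (p q : ι → V) (φ ψ : ι → T ≃* T) (hp : ∀ e ∈ E, p e ∈ W) (hq : ∀ e ∈ E, q e ∈ W) :
    ∃ z : ι → T, ∀ t : V → T, ∃ e ∈ E, z e ≠ φ e (t (p e)) * (ψ e (t (q e)))⁻¹ := by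
  induction E using Finset.induction_on generalizing W p q φ ψ with
  | empty => exact absurd hE Finset.not_nonempty_empty
  | insert e₀ E he₀ ih =>
    by_contra! hsolve
    have hp₀ := hp e₀ (Finset.mem_insert_self _ _)
    have hq₀ := hq e₀ (Finset.mem_insert_self _ _)
    by_cases hloop : p e₀ = q e₀
    · refine hT ((φ e₀).symm.trans (ψ e₀)) fun y => ?_
      obtain ⟨t, ht⟩ := hsolve fun _ => y
      refine ⟨(φ e₀ (t (p e₀)))⁻¹, ?_⟩
      rw [ht e₀ (Finset.mem_insert_self _ _), ← hloop]
      simp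
    · have hEne : E.Nonempty := by
        rw [Finset.nonempty_iff_ne_empty]
        rintro rfl
        have := Finset.one_lt_card.2 ⟨_, hp₀, _, hq₀, hloop⟩
        simp at hcard
        omega
      have hcard' : (W.erase (q e₀)).card ≤ E.card := by
        rw [Finset.card_erase_of_mem hq₀]
        rw [Finset.card_insert_of_notMem he₀] at hcard
        omega
      let θ : T ≃* T := (φ e₀).trans (ψ e₀).symm
      have hmem : ∀ v ∈ W, (if v = q e₀ then p e₀ else v) ∈ W.erase (q e₀) := by
        intro v hv
        split_ifs with h
        · exact Finset.mem_erase.2 ⟨hloop, hp₀⟩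
        · exact Finset.mem_erase.2 ⟨h, hv⟩
      obtain ⟨z, hz⟩ := ih (W.erase (q e₀)) hEne hcard'
        (fun e => if p e = q e₀ then p e₀ else p e)
        (fun e => if q e = q e₀ then p e₀ else q e)
        (fun e => if p e = q e₀ then θ.trans (φ e) else φ e)
        (fun e => if q e = q e₀ then θ.trans (ψ e) else ψ e)
        (fun e he => hmem _ (hp e (Finset.mem_insert_of_mem he)))
        (fun e he => hmem _ (hq e (Finset.mem_insert_of_mem he)))
      obtain ⟨t, ht⟩ := hsolve (Function.update z e₀ 1)
      have hθ : θ (t (p e₀)) = t (q e₀) := by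
        have h := ht e₀ (Finset.mem_insert_self _ _)
        rw [Function.update_self, eq_comm, mul_inv_eq_one] at h
        simp [θ, h]
      have hsubst : ∀ (v : V) (χ : T ≃* T), (if v = q e₀ then θ.trans χ else χ)
          (t (if v = q e₀ then p e₀ else v)) = χ (t v) := by
        intro v χ
        split_ifs with h
        · rw [MulEquiv.trans_apply, hθ, h]
        · rfl
      obtain ⟨e, he, hne⟩ := hz t
      refine hne ?_
      have h := ht e (Finset.mem_insert_of_mem he)
      rw [Function.update_of_ne (ne_of_mem_of_not_mem he he₀)] at h
      simp only [hsubst]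
      exact h

/-- Coordinates for a product of disjoint nontrivial full strips: `a c` is the strip whose support
contains the coordinate `c`, if there is one. -/
lemma IsProductOfDisjointNontrivialFullStrips.exists_coordinates {T : Type*} [Group T] {k : ℕ}
    {X : Subgroup (Fin k → T)} (hX : IsProductOfDisjointNontrivialFullStrips X) :
    ∃ (r : ℕ) (a : Fin k → Option (Fin r)) (φ : Fin k → T ≃* T),
      2 * r ≤ k ∧ (∀ c, a c = none → 2 * r < k) ∧
      ∀ x ∈ X, ∃ t : Option (Fin r) → T, t none = 1 ∧ ∀ c, x c = φ c (t (a c)) := by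
  classical
  obtain ⟨r, H, S, hH, hS, hdisj, rfl⟩ := hX
  choose i₀ hi₀ φ hφ hHeq using hH
  let a : Fin k → Option (Fin r) := fun c => if h : ∃ i, c ∈ S i then some h.choose else none
  have ha : ∀ c i, a c = some i ↔ c ∈ S i := by
    intro c i
    by_cases h : ∃ i, c ∈ S i
    · simp only [a, dif_pos h, Option.some.injEq]
      refine ⟨fun hi => hi ▸ h.choose_spec, fun hi => ?_⟩
      by_contra hne
      exact Finset.disjoint_left.1 (hdisj _ _ hne) h.choose_spec hi
    · simp only [a, dif_neg h]
      exact ⟨nofun, fun hi => absurd ⟨i, hi⟩ h⟩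
  have hunion : 2 * r ≤ (Finset.univ.biUnion S).card := by
    rw [Finset.card_biUnion fun i _ j _ hij => hdisj i j hij]
    calc 2 * r = ∑ _i : Fin r, 2 := by simp [mul_comm]
      _ ≤ _ := Finset.sum_le_sum fun i _ => hS i
  refine ⟨r, a, fun c => (a c).elim (MulEquiv.refl T) fun i => φ i c,
    hunion.trans (card_finset_fin_le _), fun c hc => hunion.trans_lt ?_, fun x hx => ?_⟩
  · have hlt : (Finset.univ.biUnion S).card < (Finset.univ : Finset (Fin k)).card := by
      refine Finset.card_lt_card (Finset.ssubset_univ_iff.2 fun h => ?_)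
      have hmem : c ∈ Finset.univ.biUnion S := h ▸ Finset.mem_univ c
      obtain ⟨i, -, hi⟩ := Finset.mem_biUnion.1 hmem
      rw [← ha, hc] at hi
      exact nomatch hi
    simpa using hlt
  · induction hx using Subgroup.iSup_induction' with
    | hp i x hx =>
      rw [← SetLike.mem_coe, hHeq] at hx
      obtain ⟨t, ht⟩ := hx
      refine ⟨Pi.mulSingle (some i) t, by simp, fun c => ?_⟩
      by_cases hc : c ∈ S i
      · rw [(ht c).1 hc]
        simp [(ha c i).2 hc]
      · rw [(ht c).2 hc, Pi.mulSingle_eq_of_ne (fun h => hc ((ha c i).1 h)), map_one]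
    | h1 => exact ⟨1, rfl, fun c => by simp⟩
    | hmul x y _ _ hx hy =>
      obtain ⟨t, ht, hxt⟩ := hx
      obtain ⟨u, hu, hyu⟩ := hy
      exact ⟨t * u, by simp [ht, hu], fun c => by simp [hxt, hyu]⟩

/-- If `T` is a group with no uniform automorphism, `k ≥ 2`, and `X, Y ≤ T^k` are both
direct products of pairwise disjoint nontrivial full strips, then `X Y ≠ T^k`. -/
theorem no_factorisation_by_strips {T : Type*} [Group T]
    (hT : ∀ α : T ≃* T, ¬ Function.Surjective fun g : T => g⁻¹ * α g)
    {k : ℕ} (hk : 2 ≤ k) (X Y : Subgroup (Fin k → T))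
    (hX : IsProductOfDisjointNontrivialFullStrips X)
    (hY : IsProductOfDisjointNontrivialFullStrips Y) :
    (X : Set (Fin k → T)) * (Y : Set (Fin k → T)) ≠ Set.univ := by
  intro hXY
  obtain ⟨r, a, φ, hr, hr', hXt⟩ := hX.exists_coordinates
  obtain ⟨s, b, ψ, hs, hs', hYu⟩ := hY.exists_coordinates
  let p : Fin k → Option (Fin r ⊕ Fin s) := fun c => (a c).map Sum.inl
  let q : Fin k → Option (Fin r ⊕ Fin s) := fun c => (b c).map Sum.inr
  obtain ⟨W, hW, hp, hq⟩ : ∃ W : Finset (Option (Fin r ⊕ Fin s)),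
      W.card ≤ k ∧ (∀ c, p c ∈ W) ∧ ∀ c, q c ∈ W := by
    by_cases h : ∃ c, a c = none ∨ b c = none
    · refine ⟨Finset.univ, ?_, fun c => Finset.mem_univ _, fun c => Finset.mem_univ _⟩
      simp only [Finset.card_univ, Fintype.card_option, Fintype.card_sum, Fintype.card_fin]
      obtain ⟨c, hc | hc⟩ := h
      · have := hr' c hc
        omega
      · have := hs' c hc
        omega
    · push Not at h
      refine ⟨Finset.univ.erase none, ?_, fun c => ?_, fun c => ?_⟩
      · rw [Finset.card_erase_of_mem (Finset.mem_univ _)]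
        simp only [Finset.card_univ, Fintype.card_option, Fintype.card_sum, Fintype.card_fin]
        omega
      · simpa [p] using (h c).1
      · simpa [q] using (h c).2
  obtain ⟨z, hz⟩ := exists_unsolvable_of_card_le hT Finset.univ W
    ⟨⟨0, by omega⟩, Finset.mem_univ _⟩ (by simpa using hW) p q φ ψ
    (fun c _ => hp c) (fun c _ => hq c)
  obtain ⟨x, hx, y, hy, rfl⟩ := Set.mem_mul.1 (hXY ▸ Set.mem_univ z)
  obtain ⟨t, ht, hxt⟩ := hXt x hx
  obtain ⟨u, hu, hyu⟩ := hYu y hy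
  obtain ⟨c, -, hc⟩ := hz fun v =>
    v.elim 1 (Sum.elim (fun i => t (some i)) fun j => (u (some j))⁻¹)
  refine hc ?_
  rw [Pi.mul_apply, hxt, hyu]
  congr 1
  · cases h : a c <;> simp [p, h, ht]
  · cases h : b c <;> simp [q, h, hu]
end

section
/- For any group G the following two assertions are equivalent: (1) there exist automorphisms α and β of G such that, writing X = {(g, α(g)) : g ∈ G} and Y = {(g, β(g)) : g ∈ G}, one has XY = G × G; (2) G admits a uniform automorphism. -/
open scoped Pointwise

/-- For a group `G`, there exist automorphisms `α, β` of `G` such that the two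
"diagonal" full strips `X = {(g, α g)}` and `Y = {(g, β g)}` satisfy `X * Y = G × G`
if and only if `G` admits a uniform automorphism. -/
theorem strip_factorisation_iff_uniform_automorphism {G : Type*} [Group G] :
    (∃ α β : G ≃* G,
        {p : G × G | ∃ g : G, p = (g, α g)} * {p : G × G | ∃ g : G, p = (g, β g)} =
          (Set.univ : Set (G × G))) ↔
      ∃ α : G ≃* G, Function.Surjective fun g : G => g⁻¹ * α g := by
  constructor
  · rintro ⟨α, β, h⟩
    refine ⟨β.trans α.symm, fun t => ?_⟩
    have ht : ((1, α t) : G × G) ∈ (Set.univ : Set (G × G)) := Set.mem_univ _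
    rw [← h] at ht
    obtain ⟨_, ⟨a, rfl⟩, _, ⟨b, rfl⟩, hab⟩ := ht
    obtain ⟨h₁, h₂⟩ := Prod.mk.inj hab
    have ha : a = b⁻¹ := eq_inv_of_mul_eq_one_left h₁
    refine ⟨b, α.injective ?_⟩
    simpa [ha] using h₂
  · rintro ⟨γ, hγ⟩
    refine ⟨MulEquiv.refl G, γ, Set.eq_univ_of_forall fun ⟨x, y⟩ => ?_⟩
    obtain ⟨b, hb⟩ := hγ (x⁻¹ * y)
    refine ⟨_, ⟨x * b⁻¹, rfl⟩, _, ⟨b, rfl⟩, Prod.ext (by simp) ?_⟩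
    have hb' : b⁻¹ * γ b = x⁻¹ * y := hb
    simp [mul_assoc, hb']
end

section
/- Let T be a group, let d ≥ 1, and let α₁,…,α_d, β₁,…,β_d be automorphisms of T. Define the following subgroups of T^{2d}: X = {(t₁, α₁(t₁), t₂, α₂(t₂), …, t_d, α_d(t_d)) : t₁,…,t_d ∈ T} and Y = {(β_d(s_d), s₁, β₁(s₁), s₂, β₂(s₂), …, s_{d-1}, β_{d-1}(s_{d-1}), s_d) : s₁,…,s_d ∈ T}. Then XY = T^{2d} if and only if the automorphism α₁β₁α₂β₂⋯α_dβ_d of T is uniform. -/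
open scoped Pointwise

/-- `t` is a solution of the twisted recurrence `t (i + 1) = c i * γ i (t i)`. -/
def IsTwistedPath {T : Type*} [Group T] {n : ℕ} (γ : Fin n → T ≃* T) (c : Fin n → T)
    (t : Fin (n + 1) → T) : Prop :=
  ∀ i, t i.succ = c i * γ i (t i.castSucc)

/-- The left-to-right composite `γ₀γ₁⋯`. -/
def composite {T : Type*} [Group T] {n : ℕ} (γ : Fin n → T ≃* T) : T ≃* T :=
  (List.ofFn γ).foldl MulEquiv.trans (MulEquiv.refl T)

theorem composite_succ_apply {T : Type*} [Group T] {n : ℕ} (γ : Fin (n + 1) → T ≃* T) (x : T) :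
    composite γ x = γ (Fin.last n) (composite (fun i => γ i.castSucc) x) := by
  rw [composite, List.ofFn_succ', List.concat_eq_append, List.foldl_append]
  rfl

theorem exists_isTwistedPath_succ {T : Type*} [Group T] {n : ℕ} (γ : Fin (n + 1) → T ≃* T)
    (c : Fin (n + 1) → T) (x y : T) :
    (∃ t, IsTwistedPath γ c t ∧ t 0 = x ∧ t (Fin.last _) = y) ↔
      ∃ z, (∃ t, IsTwistedPath (fun i => γ i.castSucc) (fun i => c i.castSucc) t ∧
        t 0 = x ∧ t (Fin.last _) = z) ∧ y = c (Fin.last n) * γ (Fin.last n) z := by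
  constructor
  · rintro ⟨t, ht, rfl, rfl⟩
    exact ⟨_, ⟨fun i => t i.castSucc, fun i => ht i.castSucc, rfl, rfl⟩, ht (Fin.last n)⟩
  · rintro ⟨_, ⟨t, ht, rfl, rfl⟩, rfl⟩
    refine ⟨Fin.snoc (α := fun _ => T) t (c (Fin.last n) * γ (Fin.last n) (t (Fin.last n))),
      fun i => ?_, ?_, by simp⟩
    · induction i using Fin.lastCases with
      | last => simp
      | cast i => rw [Fin.succ_castSucc, Fin.snoc_castSucc, Fin.snoc_castSucc]; exact ht i
    · exact Fin.snoc_castSucc (α := fun _ => T) _ t 0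

theorem exists_translation {T : Type*} [Group T] {n : ℕ} (γ : Fin n → T ≃* T) (c : Fin n → T) :
    ∃ k : T, ∀ x y, (∃ t, IsTwistedPath γ c t ∧ t 0 = x ∧ t (Fin.last _) = y) ↔
      y = k * composite γ x := by
  induction n with
  | zero =>
    refine ⟨1, fun x y => ⟨?_, ?_⟩⟩
    · rintro ⟨t, -, rfl, rfl⟩
      simp [composite]
    · intro h
      exact ⟨fun _ => x, fun i => i.elim0, rfl, by simpa [composite] using h.symm⟩
  | succ n ih =>
    obtain ⟨k, hk⟩ := ih (fun i => γ i.castSucc) (fun i => c i.castSucc)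
    refine ⟨c (Fin.last n) * γ (Fin.last n) k, fun x y => ?_⟩
    simp only [exists_isTwistedPath_succ, hk]
    simp [composite_succ_apply, mul_assoc]

theorem exists_coefficients {T : Type*} [Group T] {n : ℕ} (γ : Fin (n + 1) → T ≃* T) (k : T) :
    ∃ c : Fin (n + 1) → T, ∀ x y,
      (∃ t, IsTwistedPath γ c t ∧ t 0 = x ∧ t (Fin.last _) = y) ↔ y = k * composite γ x := by
  obtain ⟨l, hl⟩ := exists_translation (fun i : Fin n => γ i.castSucc) (fun _ => 1)
  refine ⟨Fin.snoc (α := fun _ => T) (fun _ => 1) (k * (γ (Fin.last n) l)⁻¹), fun x y => ?_⟩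
  simp only [exists_isTwistedPath_succ, Fin.snoc_castSucc, hl]
  simp [composite_succ_apply, mul_assoc]

theorem exists_cyclic_iff {T : Type*} [Group T] {d : ℕ} (γ : Fin (d + 1) → T ≃* T)
    (c : Fin (d + 1) → T) :
    (∃ t : Fin (d + 1) → T, ∀ i, t (i + 1) = c i * γ i (t i)) ↔
      ∃ x, ∃ t, IsTwistedPath γ c t ∧ t 0 = x ∧ t (Fin.last _) = x := by
  constructor
  · rintro ⟨t, ht⟩
    refine ⟨t 0, Fin.snoc (α := fun _ => T) t (t 0), fun i => ?_, ?_, by simp⟩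
    · rw [Fin.snoc_castSucc, ← ht i]
      induction i using Fin.lastCases with
      | last => simp
      | cast i => rw [Fin.succ_castSucc, Fin.snoc_castSucc, Fin.coeSucc_eq_succ]
    · exact Fin.snoc_castSucc (α := fun _ => T) (t 0) t 0
  · rintro ⟨x, t, ht, h0, hx⟩
    refine ⟨fun i => t i.castSucc, fun i => ?_⟩
    rw [← ht i]
    induction i using Fin.lastCases with
    | last => simp [h0, hx]
    | cast i => rw [Fin.coeSucc_eq_succ, Fin.succ_castSucc]

theorem forall_exists_cyclic_iff {T : Type*} [Group T] {d : ℕ} (γ : Fin (d + 1) → T ≃* T) :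
    (∀ c : Fin (d + 1) → T, ∃ t : Fin (d + 1) → T, ∀ i, t (i + 1) = c i * γ i (t i)) ↔
      Function.Surjective fun x : T => x⁻¹ * composite γ x := by
  have key (k x : T) : x = k * composite γ x ↔ x⁻¹⁻¹ * composite γ x⁻¹ = k := by
    rw [map_inv, inv_inv, mul_inv_eq_iff_eq_mul]
  simp only [exists_cyclic_iff]
  constructor
  · intro h k
    obtain ⟨c, hc⟩ := exists_coefficients γ k
    obtain ⟨x, hx⟩ := h c
    exact ⟨x⁻¹, (key k x).1 ((hc x x).1 hx)⟩
  · intro h c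
    obtain ⟨k, hk⟩ := exists_translation γ c
    obtain ⟨x, hx⟩ := h k
    refine ⟨x⁻¹, (hk _ _).2 ((key k x⁻¹).2 ?_)⟩
    simpa using hx

theorem mem_strips_mul_iff {T : Type*} [Group T] {d : ℕ} (α β : Fin (d + 1) → T ≃* T)
    (f : Fin (d + 1) → T × T) :
    f ∈ {f : Fin (d + 1) → T × T | ∃ t : Fin (d + 1) → T, f = fun i => (t i, α i (t i))} *
        {f : Fin (d + 1) → T × T |
          ∃ s : Fin (d + 1) → T, f = fun i => (β (i - 1) (s (i - 1)), s i)} ↔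
      ∃ t : Fin (d + 1) → T, ∀ i,
        t (i + 1) = (f (i + 1)).1 * (β i (f i).2)⁻¹ * (α i).trans (β i) (t i) := by
  rw [Set.mem_mul]
  constructor
  · rintro ⟨_, ⟨t, rfl⟩, _, ⟨s, rfl⟩, rfl⟩
    exact ⟨t, fun i => by simp [mul_assoc]⟩
  · rintro ⟨t, ht⟩
    refine ⟨_, ⟨t, rfl⟩, _, ⟨fun i => (α i (t i))⁻¹ * (f i).2, rfl⟩, ?_⟩
    funext i
    have h := ht (i - 1)
    rw [sub_add_cancel] at h
    refine Prod.ext ?_ (by simp)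
    simp [h, mul_assoc]

/-- Lemma on double strips: for a group `T`, `d ≥ 1` (here `d + 1` with `d : ℕ`), and
automorphisms `α₀, …, α_d, β₀, …, β_d` of `T`, model `T^{2(d+1)}` as `Fin (d+1) → T × T`,
where the `i`-th pair records coordinates `(2i+1, 2i+2)` (1-based).  Then with
`X = {(t₀, α₀ t₀, t₁, α₁ t₁, …)}` and `Y = {(β_d s_d, s₀, β₀ s₀, s₁, β₁ s₁, …, s_d)}`,
one has `X * Y = T^{2(d+1)}` if and only if the automorphism
`α₀β₀α₁β₁⋯α_dβ_d` (composed left to right) is uniform. -/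
theorem doublestrips_factorisation_iff_uniform {T : Type*} [Group T] (d : ℕ)
    (α β : Fin (d + 1) → T ≃* T) :
    ({f : Fin (d + 1) → T × T | ∃ t : Fin (d + 1) → T, f = fun i => (t i, α i (t i))} *
        {f : Fin (d + 1) → T × T |
          ∃ s : Fin (d + 1) → T, f = fun i => (β (i - 1) (s (i - 1)), s i)} =
      (Set.univ : Set (Fin (d + 1) → T × T))) ↔
    Function.Surjective fun x : T =>
      x⁻¹ *
        ((List.ofFn fun i => (α i).trans (β i)).foldl MulEquiv.trans (MulEquiv.refl T)) x := by
  rw [Set.eq_univ_iff_forall]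
  refine Iff.trans ?_ (forall_exists_cyclic_iff fun i => (α i).trans (β i))
  simp only [mem_strips_mul_iff]
  refine ⟨fun h c => ?_, fun h f => h _⟩
  simpa using h fun i => (c (i - 1), 1)
end

section
/- Let T be a group, let r ≥ 1, and let α₁,…,α_r, β₁,…,β_r be automorphisms of T. Define the following subgroups of T^{2r+1}: X = {(t₁, α₁(t₁), t₂, α₂(t₂), …, t_r, α_r(t_r), 1) : t₁,…,t_r ∈ T} and Y = {(1, s₁, β₁(s₁), s₂, β₂(s₂), …, s_r, β_r(s_r)) : s₁,…,s_r ∈ T}. Then for every x ∈ T, if the tuple (x, 1, 1, …, 1) lies in XY, then x = 1; in particular, if T is nontrivial then XY ≠ T^{2r+1}. -/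
open scoped Pointwise

/-- `X = {(t₁, α₁(t₁), …, t_r, α_r(t_r), 1)}` as a subset of `T^{2r+1}` (0-based:
coordinate `2i` is `t i`, coordinate `2i+1` is `α i (t i)`, last coordinate is `1`). -/
def stripSetX {T : Type*} [Group T] {r : ℕ} (α : Fin r → T ≃* T) :
    Set (Fin (2 * r + 1) → T) :=
  {f | ∃ t : Fin r → T,
    (∀ i : Fin r,
        f ⟨2 * i.val, by have := i.isLt; omega⟩ = t i ∧
          f ⟨2 * i.val + 1, by have := i.isLt; omega⟩ = α i (t i)) ∧
      f ⟨2 * r, by omega⟩ = 1}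

/-- `Y = {(1, s₁, β₁(s₁), …, s_r, β_r(s_r))}` as a subset of `T^{2r+1}` (0-based:
coordinate `0` is `1`, coordinate `2i+1` is `s i`, coordinate `2i+2` is `β i (s i)`). -/
def stripSetY {T : Type*} [Group T] {r : ℕ} (β : Fin r → T ≃* T) :
    Set (Fin (2 * r + 1) → T) :=
  {f | ∃ s : Fin r → T,
    f ⟨0, by omega⟩ = 1 ∧
      ∀ i : Fin r,
        f ⟨2 * i.val + 1, by have := i.isLt; omega⟩ = s i ∧
          f ⟨2 * i.val + 2, by have := i.isLt; omega⟩ = β i (s i)}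

/-- Let `T` be a group, `r ≥ 1`, and `α₁,…,α_r, β₁,…,β_r` automorphisms of `T`.
For the subgroups `X = {(t₁, α₁(t₁), …, t_r, α_r(t_r), 1)}` and
`Y = {(1, s₁, β₁(s₁), …, s_r, β_r(s_r))}` of `T^{2r+1}`: if the tuple `(x, 1, …, 1)`
lies in `X * Y` then `x = 1`; in particular, for nontrivial `T`, `X * Y ≠ T^{2r+1}`. -/
theorem path_strip_factorisation_fails {T : Type*} [Group T] {r : ℕ} (hr : 1 ≤ r)
    (α β : Fin r → T ≃* T) :
    (∀ x : T,
        (fun j : Fin (2 * r + 1) => if j.val = 0 then x else 1) ∈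
            stripSetX α * stripSetY β →
          x = 1) ∧
      (Nontrivial T → stripSetX α * stripSetY β ≠ Set.univ) := by
  have trivial_of_mem : ∀ x : T,
      (fun j : Fin (2 * r + 1) => if j.val = 0 then x else 1) ∈
        stripSetX α * stripSetY β → x = 1 := by
    rintro x ⟨f, ⟨t, hft, hf_last⟩, g, ⟨s, hg_zero, hgs⟩, hfg⟩
    have hmul (j : Fin (2 * r + 1)) : f j * g j = if j.val = 0 then x else 1 :=
      congrFun hfg j
    have heven (k : ℕ) (hk : k ≤ r) : f ⟨2 * k, by omega⟩ = 1 := by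
      induction hk using Nat.decreasingInduction with
      | self => exact hf_last
      | of_succ i hi ih =>
        obtain ⟨ht_even, ht_odd⟩ := hft ⟨i, hi⟩
        obtain ⟨hs_odd, hs_even⟩ := hgs ⟨i, hi⟩
        have hprod_even := hmul ⟨2 * i + 2, by omega⟩
        have hprod_odd := hmul ⟨2 * i + 1, by omega⟩
        have hf_next : f ⟨2 * i + 2, by omega⟩ = 1 := ih
        have hs : s ⟨i, hi⟩ = 1 := by simpa [hf_next, hs_even] using hprod_even
        have ht : t ⟨i, hi⟩ = 1 := by simpa [ht_odd, hs_odd, hs] using hprod_odd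
        exact ht_even.trans ht
    have hf_zero : f ⟨0, by omega⟩ = 1 := heven 0 (Nat.zero_le r)
    have hprod_zero := hmul ⟨0, by omega⟩
    rw [hf_zero, hg_zero] at hprod_zero
    simpa using hprod_zero.symm
  refine ⟨trivial_of_mem, fun _ huniv => ?_⟩
  obtain ⟨x, hx⟩ := exists_ne (1 : T)
  exact hx (trivial_of_mem x (huniv ▸ Set.mem_univ _))
end

section
/- Let Γ be a set with |Γ| ≥ 2, let ℓ ≥ 2 be an integer, and let W = Sym(Γ) wr Sym(ℓ) act on Ω = Γ^ℓ in product action. Let G be a subgroup of W and let M be a minimal normal subgroup of G that acts transitively on Γ^ℓ. Then M is contained in the base group (Sym Γ)^ℓ of W; that is, every element of M acts coordinatewise on Γ^ℓ without permuting the ℓ coordinates. -/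
/-- `w` acts on `ι → Γ` as an element of `Sym Γ wr Sym ι` in product action whose image in the
top group is `σ`. -/
def InducesOnCoordinates {Γ ι : Type*} (w : Equiv.Perm (ι → Γ)) (σ : Equiv.Perm ι) : Prop :=
  ∃ g : ι → Equiv.Perm Γ, ∀ v : ι → Γ, w v = fun i => g (σ.symm i) (v (σ.symm i))

theorem InducesOnCoordinates.mul {Γ ι : Type*} {w₁ w₂ : Equiv.Perm (ι → Γ)}
    {σ₁ σ₂ : Equiv.Perm ι} (h₁ : InducesOnCoordinates w₁ σ₁) (h₂ : InducesOnCoordinates w₂ σ₂) :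
    InducesOnCoordinates (w₁ * w₂) (σ₁ * σ₂) := by
  obtain ⟨g₁, h₁⟩ := h₁
  obtain ⟨g₂, h₂⟩ := h₂
  refine ⟨fun j => g₁ (σ₂ j) * g₂ j, fun v => funext fun i => ?_⟩
  have hsymm : (σ₁ * σ₂).symm i = σ₂.symm (σ₁.symm i) := rfl
  simp [h₁, h₂, hsymm]

theorem InducesOnCoordinates.unique {Γ ι : Type*} [Nontrivial Γ] {w : Equiv.Perm (ι → Γ)}
    {σ τ : Equiv.Perm ι} (hσ : InducesOnCoordinates w σ) (hτ : InducesOnCoordinates w τ) :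
    σ = τ := by
  classical
  obtain ⟨g, hg⟩ := hσ
  obtain ⟨k, hk⟩ := hτ
  obtain ⟨a, b, hab⟩ := exists_pair_ne Γ
  have hsymm : σ.symm = τ.symm := by
    ext i
    by_contra hne
    have hw : w (fun _ => a) i = w (Function.update (fun _ => a) (σ.symm i) b) i := by
      rw [hk, hk]
      simp [Function.update_of_ne (Ne.symm hne)]
    rw [hg, hg] at hw
    exact hab (by simpa using hw)
  simpa using congrArg Equiv.symm hsymm

/-- A subgroup of the wreath product in product action maps homomorphically to the top group. -/
theorem exists_hom_inducesOnCoordinates {Γ ι : Type*} [Nontrivial Γ]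
    (W : Subgroup (Equiv.Perm (ι → Γ))) (hW : ∀ w ∈ W, ∃ σ, InducesOnCoordinates w σ) :
    ∃ f : W →* Equiv.Perm ι, ∀ w : W, InducesOnCoordinates (w : Equiv.Perm (ι → Γ)) (f w) := by
  choose f hf using fun w : W => hW w w.2
  exact ⟨MonoidHom.mk' f fun a b => (hf (a * b)).unique ((hf a).mul (hf b)), hf⟩

theorem not_pow_dvd_factorial {n ℓ : ℕ} (hn : n ≠ 1) (hℓ : ℓ ≠ 0) : ¬ n ^ ℓ ∣ ℓ.factorial := by
  intro hdvd
  have : Fact n.minFac.Prime := ⟨Nat.minFac_prime hn⟩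
  have hp : n.minFac ^ ℓ ∣ ℓ.factorial := (pow_dvd_pow_of_dvd n.minFac_dvd ℓ).trans hdvd
  have hle := (padicValNat_dvd_iff_le ℓ.factorial_ne_zero).1 hp
  exact hle.not_gt (padicValNat_factorial_lt_of_ne_zero n.minFac hℓ)

/-- A group acting faithfully on `ℓ ≠ 0` points has no transitive action on `ℓ`-tuples. -/
theorem not_injective_of_isPretransitive {Γ M : Type*} [Nontrivial Γ] [Group M] {ℓ : ℕ}
    (hℓ : ℓ ≠ 0) [MulAction M (Fin ℓ → Γ)] [MulAction.IsPretransitive M (Fin ℓ → Γ)]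
    (f : M →* Equiv.Perm (Fin ℓ)) : ¬ Function.Injective f := by
  intro hf
  have hcard : Nat.card M ∣ ℓ.factorial := by
    simpa [Fintype.card_perm] using Subgroup.card_dvd_of_injective f hf
  obtain ⟨a, -⟩ := exists_pair_ne Γ
  have hindex := (MulAction.stabilizer M (fun _ : Fin ℓ => a)).index_dvd_card
  rw [MulAction.index_stabilizer_of_transitive, Nat.card_fun, Nat.card_fin] at hindex
  refine not_pow_dvd_factorial (fun h => ?_) hℓ (hindex.trans hcard)
  exact not_subsingleton Γ (Nat.card_eq_one_iff_unique.1 h).1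

/-- Let `Γ` be a set with at least two elements, `ℓ ≥ 2`, and let
`W ≤ Sym(Γ^ℓ)` be the wreath product `Sym Γ wr Sym ℓ` in product action, i.e. the
subgroup of all permutations `(γ₁,…,γ_ℓ) ↦ (g_{1σ⁻¹}(γ_{1σ⁻¹}),…,g_{ℓσ⁻¹}(γ_{ℓσ⁻¹}))`.
If `G ≤ W` and `M` is a minimal normal subgroup of `G` that is transitive on `Γ^ℓ`,
then `M` lies in the base group `(Sym Γ)^ℓ`: every element of `M` acts coordinatewise
without permuting the `ℓ` coordinates. -/
theorem minimal_normal_transitive_le_base_group {Γ : Type*} (hΓ : Nontrivial Γ)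
    {ℓ : ℕ} (hℓ : 2 ≤ ℓ)
    (W G M : Subgroup (Equiv.Perm (Fin ℓ → Γ)))
    (hW : (W : Set (Equiv.Perm (Fin ℓ → Γ))) =
      {w | ∃ (g : Fin ℓ → Equiv.Perm Γ) (σ : Equiv.Perm (Fin ℓ)),
        ∀ v : Fin ℓ → Γ, w v = fun i => g (σ.symm i) (v (σ.symm i))})
    (hGW : G ≤ W) (hMG : M ≤ G) (hMbot : M ≠ ⊥)
    (hMnorm : ∀ g ∈ G, ∀ m ∈ M, g * m * g⁻¹ ∈ M)
    (hMmin : ∀ N : Subgroup (Equiv.Perm (Fin ℓ → Γ)), N ≤ M → N ≠ ⊥ →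
      (∀ g ∈ G, ∀ n ∈ N, g * n * g⁻¹ ∈ N) → N = M)
    (htrans : ∀ x y : Fin ℓ → Γ, ∃ m ∈ M, m x = y) :
    ∀ m ∈ M, ∃ g : Fin ℓ → Equiv.Perm Γ,
      ∀ v : Fin ℓ → Γ, m v = fun i => g i (v i) := by
  obtain ⟨f, hf⟩ := exists_hom_inducesOnCoordinates W fun w hw => by
    obtain ⟨g, σ, h⟩ := hW.subset hw
    exact ⟨σ, g, h⟩
  have hMW : M ≤ W := hMG.trans hGW
  have hN : M ⊓ f.ker.map W.subtype = M := by
    refine hMmin _ inf_le_left (fun hbot => ?_) ?_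
    · have : MulAction.IsPretransitive M (Fin ℓ → Γ) := ⟨fun x y => by
        obtain ⟨m, hm, h⟩ := htrans x y
        exact ⟨⟨m, hm⟩, h⟩⟩
      refine not_injective_of_isPretransitive (Γ := Γ) (by omega)
        (f.comp (Subgroup.inclusion hMW)) ?_
      refine (injective_iff_map_eq_one _).2 fun m hm => Subtype.ext ?_
      exact (Subgroup.eq_bot_iff_forall _).1 hbot m
        ⟨m.2, Subgroup.inclusion hMW m, f.mem_ker.2 hm, rfl⟩
    · rintro g hg _ ⟨hnM, n, hn, rfl⟩
      exact ⟨hMnorm g hg _ hnM, _, f.normal_ker.conj_mem n hn ⟨g, hGW hg⟩, rfl⟩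
  intro m hm
  obtain ⟨-, w, hw, rfl⟩ := hN.ge hm
  obtain ⟨g, hg⟩ := hf w
  rw [f.mem_ker.1 hw] at hg
  exact ⟨g, hg⟩
end

section
/- Let Γ be a set with |Γ| ≥ 2, let ℓ ≥ 2, and let M be a subgroup of the direct power (Sym Γ)^ℓ, acting coordinatewise on Γ^ℓ via (γ₁,…,γ_ℓ)·m = (m₁(γ₁),…,m_ℓ(γ_ℓ)) for m = (m₁,…,m_ℓ) ∈ M. Assume M is transitive on Γ^ℓ. Fix γ ∈ Γ and for i = 1,…,ℓ let K_i = {m ∈ M : m_i(γ) = γ}. Then each K_i is a proper subgroup of M, the family {K₁,…,K_ℓ} is an abstract cartesian factorisation of M, i.e. M = K_i·(⋂_{j≠i} K_j) for every i, and ⋂_{i=1}^{ℓ} K_i equals the stabiliser in M of the constant point ω = (γ,…,γ) ∈ Γ^ℓ. -/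
open scoped Pointwise

/-- Let `Γ` have at least two elements, `ℓ ≥ 2`, and let `M ≤ (Sym Γ)^ℓ` act
coordinatewise on `Γ^ℓ` and be transitive.  Fix `γ ∈ Γ` and set
`K i = {m ∈ M : m i γ = γ}`.  Then each `K i` is a proper subgroup of `M`, the family
`{K₁,…,K_ℓ}` is an abstract cartesian factorisation of `M`
(`M = K_i ⋅ ⋂_{j ≠ i} K_j` for each `i`), and `⋂ K i` is the stabiliser in `M` of the
constant point `ω = (γ,…,γ)`. -/
theorem transitive_coordinatewise_cartesian_factorisation {Γ : Type*}
    (hΓ : Nontrivial Γ) {ℓ : ℕ} (hℓ : 2 ≤ ℓ)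
    (M : Subgroup (Fin ℓ → Equiv.Perm Γ))
    (htrans : ∀ x y : Fin ℓ → Γ, ∃ m ∈ M, ∀ i, m i (x i) = y i)
    (γ : Γ)
    (K : Fin ℓ → Subgroup (Fin ℓ → Equiv.Perm Γ))
    (hK : ∀ i, K i = M ⊓ (MulAction.stabilizer (Equiv.Perm Γ) γ).comap
      (Pi.evalMonoidHom (fun _ : Fin ℓ => Equiv.Perm Γ) i)) :
    (∀ i, K i < M) ∧
      (∀ i, (K i : Set (Fin ℓ → Equiv.Perm Γ)) *
          ((⨅ j ≠ i, K j : Subgroup (Fin ℓ → Equiv.Perm Γ)) :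
            Set (Fin ℓ → Equiv.Perm Γ)) = (M : Set (Fin ℓ → Equiv.Perm Γ))) ∧
      (∀ m, m ∈ ⨅ i, K i ↔ m ∈ M ∧ ∀ i, m i γ = γ) := by
  have mem_K : ∀ i m, m ∈ K i ↔ m ∈ M ∧ m i γ = γ := fun i m => by
    rw [hK]
    simp [Subgroup.mem_inf, MulAction.mem_stabilizer_iff]
  have le_M : ∀ i, K i ≤ M := fun i m hm => ((mem_K i m).1 hm).1
  have : Nontrivial (Fin ℓ) := Fin.nontrivial_iff_two_le.2 hℓ
  refine ⟨fun i => (le_M i).lt_of_not_ge fun hle => ?_, fun i => ?_, fun m => ?_⟩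
  · obtain ⟨δ, hδ⟩ := exists_ne γ
    obtain ⟨m, hm, hmδ⟩ := htrans (fun _ => γ) (fun _ => δ)
    exact hδ ((hmδ i).symm.trans ((mem_K i m).1 (hle hm)).2)
  · apply Set.Subset.antisymm
    · obtain ⟨j, hj⟩ := exists_ne i
      rintro _ ⟨a, ha, b, hb, rfl⟩
      have hbj : b ∈ K j := (iInf₂_le j hj : ⨅ j ≠ i, K j ≤ K j) hb
      exact M.mul_mem (le_M i ha) (le_M j hbj)
    · intro m hm
      -- `c` moves `γ` to `(m i)⁻¹ γ` in coordinate `i` and fixes it in all others.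
      obtain ⟨c, hc, hcγ⟩ := htrans (fun _ => γ) (Function.update (fun _ => γ) i ((m i)⁻¹ γ))
      refine ⟨m * c, (mem_K i _).2 ⟨M.mul_mem hm hc, ?_⟩, c⁻¹, ?_, mul_inv_cancel_right m c⟩
      · simp [hcγ i]
      · simp only [SetLike.mem_coe, Subgroup.mem_iInf]
        refine fun j hj => (K j).inv_mem ((mem_K j c).2 ⟨hc, ?_⟩)
        simpa [hj] using hcγ j
  · simp only [Subgroup.mem_iInf, mem_K, forall_and, forall_const]
end

section
/- Let G be a group admitting automorphisms α₂ and α₃ such that the map G → G × G given by t ↦ (t⁻¹·α₂(t), t⁻¹·α₃(t)) is surjective. Define the subgroups X = {(t,t,t,s,s,s) : t, s ∈ G} and Y = {(t₁, t₂, t₃, t₁, α₂(t₂), α₃(t₃)) : t₁, t₂, t₃ ∈ G} of G^6. Then XY = G^6. -/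
open scoped Pointwise

/-- If a group `G` admits automorphisms `α₂, α₃` such that
`t ↦ (t⁻¹ * α₂ t, t⁻¹ * α₃ t)` is surjective onto `G × G`, then the subgroups
`X = {(t,t,t,s,s,s)}` and `Y = {(t₁,t₂,t₃,t₁,α₂ t₂,α₃ t₃)}` of `G^6` satisfy `X * Y = G^6`. -/
theorem g6_strip_factorisation {G : Type*} [Group G] (α₂ α₃ : G ≃* G)
    (hsurj : Function.Surjective fun t : G => (t⁻¹ * α₂ t, t⁻¹ * α₃ t)) :
    {f : Fin 6 → G | ∃ t s : G, f = ![t, t, t, s, s, s]} *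
        {f : Fin 6 → G | ∃ t₁ t₂ t₃ : G, f = ![t₁, t₂, t₃, t₁, α₂ t₂, α₃ t₃]} =
      (Set.univ : Set (Fin 6 → G)) := by
  refine Set.eq_univ_of_forall fun g => ?_
  obtain ⟨u, hu⟩ := hsurj
    (g 0 * (g 3)⁻¹ * g 4 * (α₂ (g 1))⁻¹, g 0 * (g 3)⁻¹ * g 5 * (α₃ (g 2))⁻¹)
  obtain ⟨h₂, h₃⟩ := Prod.mk.inj hu
  rw [inv_mul_eq_iff_eq_mul] at h₂ h₃
  refine Set.mem_mul.2 ⟨_, ⟨u⁻¹, g 3 * (g 0)⁻¹ * u⁻¹, rfl⟩, _,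
    ⟨u * g 0, u * g 1, u * g 2, rfl⟩, ?_⟩
  ext i
  fin_cases i <;> simp [h₂, h₃, mul_assoc]
end
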